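/- A function f : ℝ≥0 → ℝ≥0 is ultrametric-preserving if and only if f is an endomorphism of the monoid (ℝ≥0, max) whose kernel is {0}; that is, if and only if f(max(a,b)) = max(f(a), f(b)) for all a,b ∈ ℝ≥0 and f(x) = 0 holds exactly when x = 0. -/

import Mathlib

open NNReal

universe u

/-- `d : X → X → ℝ≥0` is an ultrametric on `X`. -/
def IsUltrametric {X : Type u} (d : X → X → ℝ≥0) : Prop :=
  (∀ x y, d x y = 0 ↔ x = y) ∧
  (∀ x y, d x y = d y x) ∧
  (∀ x y z, d x y ≤ max (d x z) (d z y))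

/-- `f : ℝ≥0 → ℝ≥0` is ultrametric-preserving. -/
def UltrametricPreserving (f : ℝ≥0 → ℝ≥0) : Prop :=
  ∀ (X : Type u) (d : X → X → ℝ≥0), IsUltrametric d →
    IsUltrametric (fun x y => f (d x y))

/-- The ultrametric on `ℝ≥0` under which distinct points are at distance their maximum. -/
noncomputable def maxDist (x y : ULift.{u} ℝ≥0) : ℝ≥0 :=
  if x = y then 0 else max x.down y.down

theorem isUltrametric_maxDist : IsUltrametric maxDist.{u} := by
  refine ⟨fun x y => ?_, fun x y => ?_, fun x y z => ?_⟩
  · unfold maxDist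
    split_ifs with h
    · simp [h]
    · simp only [h, iff_false]
      intro hxy
      have hx : x.down = 0 := le_antisymm (hxy ▸ le_max_left _ _) zero_le
      have hy : y.down = 0 := le_antisymm (hxy ▸ le_max_right _ _) zero_le
      exact h (ULift.ext _ _ (hx.trans hy.symm))
  · simp only [maxDist, eq_comm, max_comm]
  · unfold maxDist
    by_cases hxz : x = z
    · simp [hxz]
    by_cases hzy : z = y
    · simp [hzy]
    rw [if_neg hxz, if_neg hzy]
    split_ifs
    · exact zero_le
    · exact max_le_max (le_max_left _ _) (le_max_right _ _)

theorem maxDist_zero_left (a : ℝ≥0) : maxDist.{u} ⟨0⟩ ⟨a⟩ = a := by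
  unfold maxDist
  split_ifs with h
  · exact congrArg ULift.down h
  · simp

theorem maxDist_of_lt {a b : ℝ≥0} (h : a < b) : maxDist.{u} ⟨b⟩ ⟨a⟩ = b := by
  simp [maxDist, h.ne', h.le]

theorem UltrametricPreserving.eq_zero_iff {f : ℝ≥0 → ℝ≥0} (hf : UltrametricPreserving.{u} f)
    (x : ℝ≥0) : f x = 0 ↔ x = 0 := by
  have h := (hf _ _ isUltrametric_maxDist).1 ⟨0⟩ ⟨x⟩
  simpa [maxDist_zero_left, eq_comm] using h

theorem UltrametricPreserving.monotone {f : ℝ≥0 → ℝ≥0} (hf : UltrametricPreserving.{u} f) :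
    Monotone f := by
  refine monotone_iff_forall_lt.2 fun a b hab => ?_
  have h := (hf _ _ isUltrametric_maxDist).2.2 ⟨0⟩ ⟨a⟩ ⟨b⟩
  simpa [maxDist_zero_left, maxDist_of_lt hab] using h

theorem Monotone.ultrametricPreserving {f : ℝ≥0 → ℝ≥0} (hf : Monotone f)
    (h0 : ∀ x, f x = 0 ↔ x = 0) : UltrametricPreserving.{u} f :=
  fun _ _ hd =>
    ⟨fun x y => (h0 _).trans (hd.1 x y), fun x y => congrArg f (hd.2.1 x y),
      fun x y z => (hf (hd.2.2 x y z)).trans_eq hf.map_max⟩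

/-- `f` is ultrametric-preserving iff `f` is an endomorphism of the
monoid `(ℝ≥0, max)` whose kernel is `{0}`. -/
theorem ultrametricPreserving_iff_max_endomorphism_trivial_kernel (f : ℝ≥0 → ℝ≥0) :
    UltrametricPreserving.{u} f ↔
      ((∀ a b : ℝ≥0, f (max a b) = max (f a) (f b)) ∧ ∀ x : ℝ≥0, f x = 0 ↔ x = 0) := by
  refine ⟨fun hf => ⟨fun _ _ => hf.monotone.map_max, hf.eq_zero_iff⟩, fun ⟨hmax, h0⟩ => ?_⟩
  refine Monotone.ultrametricPreserving (fun a b hab => ?_) h0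
  rw [← max_eq_right hab, hmax]
  exact le_max_left _ _
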